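/- arXiv:2010.00707 — 5 statements merged into one kernel-verified Lean document; each statement's English description precedes it below -/
import Mathlib

section
/- Let n ≥ 2 be an even integer, let p_1, …, p_n be pairwise distinct prime numbers, and let m ≥ 2 be an integer such that ∑_{j=1}^{n} 1/p_j < n/2 − 1/m. Let J be the set of tuples α = (α_1, …, α_n) of integers with 0 ≤ α_j ≤ p_j − 2 for each j. If (n_α)_{α∈J} are rational numbers such that ∑_{α∈J} n_α ∏_{j=1}^{n} ζ_{p_j}^{α_j(β_j+1)} = 0 for every β = (β_1, …, β_n) ∈ J with ∑_{j=1}^{n} (β_j+1)/p_j < n/2 − 1/m, then n_α = 0 for every α ∈ J. -/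
open scoped BigOperators

/-- The standard primitive `d`-th root of unity `exp(2πi/d)`. -/
noncomputable def zeta (d : ℕ) : ℂ := Complex.exp (2 * Real.pi * Complex.I / d)

theorem zeta_prim (d : ℕ) (hd : d ≠ 0) : IsPrimitiveRoot (zeta d) d :=
  Complex.isPrimitiveRoot_exp d hd

theorem prod_prim {n : ℕ} (p : Fin n → ℕ) (hp : ∀ j, (p j).Prime)
    (hdist : Function.Injective p) (s : Finset (Fin n)) :
    orderOf (∏ j ∈ s, zeta (p j)) = ∏ j ∈ s, p j := by
  induction s using Finset.induction_on with
  | empty => simp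
  | insert a s ha ih =>
    rw [Finset.prod_insert ha, Finset.prod_insert ha]
    have h1 : orderOf (zeta (p a)) = p a := ((zeta_prim _ (hp a).ne_zero).eq_orderOf).symm
    rw [(Commute.all _ _).orderOf_mul_eq_mul_orderOf_of_coprime, h1, ih]
    rw [h1, ih]
    apply Nat.Coprime.prod_right
    intro i hi
    refine (Nat.coprime_primes (hp a) (hp i)).2 ?_
    intro h
    exact ha (hdist h ▸ hi)

theorem pow_expand (q : ℕ) (hq : q.Prime) (k : ℕ) :
    ∃ r : Fin (q - 1) → ℚ, zeta q ^ k = ∑ i, (r i : ℂ) * zeta q ^ (i : ℕ) := by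
  have hz := zeta_prim q hq.ne_zero
  have hk : zeta q ^ k = zeta q ^ (k % q) := by
    have h1 := pow_mod_orderOf (zeta q) k
    rw [← hz.eq_orderOf] at h1
    exact h1.symm
  rw [hk]
  have hlt : k % q < q := Nat.mod_lt _ hq.pos
  by_cases hc : k % q < q - 1
  · refine ⟨fun i => if i = ⟨k % q, hc⟩ then 1 else 0, ?_⟩
    rw [Finset.sum_eq_single ⟨k % q, hc⟩] <;> simp +contextual
  · have he : k % q = q - 1 := by omega
    refine ⟨fun _ => -1, ?_⟩
    have hg := hz.geom_sum_eq_zero hq.one_lt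
    obtain ⟨t, rfl⟩ : ∃ t, q = t + 1 := ⟨q - 1, by have := hq.pos; omega⟩
    rw [Finset.sum_range_succ] at hg
    rw [he, ← Finset.mul_sum, Fin.sum_univ_eq_sum_range (fun i => zeta (t + 1) ^ i)]
    simp only [Nat.add_sub_cancel]
    push_cast
    linear_combination hg

theorem li {n : ℕ} (p : Fin n → ℕ) (hp : ∀ j, (p j).Prime)
    (hdist : Function.Injective p) :
    LinearIndependent ℚ
      (fun α : (∀ j, Fin (p j - 1)) => ∏ j, zeta (p j) ^ (α j : ℕ)) := by
  classical
  set b := (fun α : (∀ j, Fin (p j - 1)) => ∏ j, zeta (p j) ^ (α j : ℕ)) with hb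
  rw [linearIndependent_iff_card_le_finrank_span]
  set x := ∏ j, zeta (p j) with hx
  set N := ∏ j, p j with hN
  have hNpos : 0 < N := Finset.prod_pos fun j _ => (hp j).pos
  have hprim : IsPrimitiveRoot x N := IsPrimitiveRoot.iff_orderOf.2 (prod_prim p hp hdist _)
  have hdeg : (minpoly ℚ x).natDegree = ∏ j, (p j - 1) := by
    rw [← Polynomial.cyclotomic_eq_minpoly_rat hprim hNpos, Polynomial.natDegree_cyclotomic]
    have : ∀ s : Finset (Fin n), Nat.totient (∏ j ∈ s, p j) = ∏ j ∈ s, (p j - 1) := by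
      intro s
      induction s using Finset.induction_on with
      | empty => simp
      | insert a s ha ih =>
        rw [Finset.prod_insert ha, Finset.prod_insert ha, Nat.totient_mul, ih,
          Nat.totient_prime (hp a)]
        apply Nat.Coprime.prod_right
        intro i hi
        exact (Nat.coprime_primes (hp a) (hp i)).2 fun h => ha (hdist h ▸ hi)
    exact this _
  have hpow := linearIndependent_pow (K := ℚ) x
  have hf := finrank_span_eq_card hpow
  rw [Fintype.card_fin, hdeg] at hf
  have hcard : Fintype.card (∀ j, Fin (p j - 1)) = ∏ j, (p j - 1) := by simp
  rw [hcard, ← hf]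
  have : FiniteDimensional ℚ (Submodule.span ℚ (Set.range b)) :=
    FiniteDimensional.span_of_finite ℚ (Set.finite_range b)
  apply Submodule.finrank_mono
  rw [Submodule.span_le]
  rintro _ ⟨k, rfl⟩
  have hr := fun j => pow_expand (p j) (hp j) k
  choose r hr using hr
  have : x ^ (k : ℕ) = ∑ α : (∀ j, Fin (p j - 1)), (∏ j, r j (α j)) • b α := by
    rw [hx, ← Finset.prod_pow, Finset.prod_congr rfl fun j _ => hr j, Finset.prod_univ_sum,
      Fintype.piFinset_univ]
    refine Finset.sum_congr rfl fun α _ => ?_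
    rw [Finset.prod_mul_distrib, hb, Rat.smul_def]
    push_cast
    rfl
  simp only [SetLike.mem_coe]
  rw [this]
  exact Submodule.sum_mem _ fun α _ =>
    Submodule.smul_mem _ _ (Submodule.subset_span ⟨α, rfl⟩)

theorem stmt6 (n : ℕ) (hn : Even n) (hn2 : 2 ≤ n)
    (p : Fin n → ℕ) (hp : ∀ j, (p j).Prime) (hdist : Function.Injective p)
    (m : ℕ) (hm : 2 ≤ m)
    (hsum : ∑ j, (1 : ℚ) / (p j) < (n : ℚ) / 2 - 1 / m)
    (c : (∀ j, Fin (p j - 1)) → ℚ)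
    (h : ∀ β : (∀ j, Fin (p j - 1)),
        (∑ j, ((β j : ℚ) + 1) / (p j) < (n : ℚ) / 2 - 1 / m) →
        ∑ α : (∀ j, Fin (p j - 1)),
          (c α : ℂ) * ∏ j, zeta (p j) ^ ((α j : ℕ) * ((β j : ℕ) + 1)) = 0) :
    ∀ α, c α = 0 := by
  have hli := Fintype.linearIndependent_iff.1 (li p hp hdist) c
  apply hli
  have h0 := h (fun j => ⟨0, by have := (hp j).two_le; omega⟩) (by simpa using hsum)
  simpa [Rat.smul_def] using h0
end

section
/- Let n be a positive even integer, let a be a rational number with 0 < a < 1, let k be a nonnegative integer, and set A = (n−1)/2 + a. Then the real number B(1/2, …, 1/2, a) · B(A + k, A) / π^{n/2}, where the first beta symbol has n−1 arguments equal to 1/2 followed by the argument a, is an algebraic number (i.e., it is a root of a nonzero polynomial with rational coefficients). -/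
open scoped BigOperators

lemma gamma_shift (q : ℚ) (hq : 0 < q) (j : ℕ) :
    ∃ r : ℚ, 0 < r ∧ Real.Gamma ((q : ℝ) + (j : ℝ)) = (r : ℝ) * Real.Gamma (q : ℝ) := by
  induction j with
  | zero => exact ⟨1, one_pos, by simp⟩
  | succ j ih =>
    obtain ⟨r, hr, h⟩ := ih
    have hp : (0 : ℝ) < (q : ℝ) + (j : ℝ) := by
      have : (0 : ℝ) < (q : ℝ) := by exact_mod_cast hq
      positivity
    refine ⟨(q + j) * r, by positivity, ?_⟩
    have h1 : (q : ℝ) + ((j + 1 : ℕ) : ℝ) = ((q : ℝ) + (j : ℝ)) + 1 := by push_cast; ring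
    rw [h1, Real.Gamma_add_one hp.ne', h]
    push_cast
    ring

lemma isAlgebraic_two_rpow (q : ℚ) : IsAlgebraic ℚ ((2 : ℝ) ^ (q : ℝ)) := by
  have hpow : ((2 : ℝ) ^ (q : ℝ)) ^ q.den = (2 : ℝ) ^ q.num := by
    rw [← Real.rpow_natCast, ← Real.rpow_mul (by norm_num), ← Real.rpow_intCast]
    congr 1
    exact_mod_cast Rat.mul_den_eq_num q
  refine IsAlgebraic.of_pow (n := q.den) q.den_pos ?_
  rw [hpow]
  have : ((2 : ℝ) ^ q.num) = algebraMap ℚ ℝ ((2 : ℚ) ^ q.num) := by simp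
  rw [this]
  exact isAlgebraic_algebraMap _

theorem stmt10 (n : ℕ) (hn : Even n) (hn0 : 0 < n)
    (a : ℚ) (ha0 : 0 < a) (ha1 : a < 1) (k : ℕ) :
    IsAlgebraic ℚ
      (((Real.Gamma (1 / 2)) ^ (n - 1) * Real.Gamma (a : ℝ) /
          Real.Gamma (((n : ℝ) - 1) / 2 + (a : ℝ))) *
        (Real.Gamma ((((n : ℝ) - 1) / 2 + (a : ℝ)) + (k : ℝ)) *
            Real.Gamma (((n : ℝ) - 1) / 2 + (a : ℝ)) /
          Real.Gamma (2 * (((n : ℝ) - 1) / 2 + (a : ℝ)) + (k : ℝ))) /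
        Real.pi ^ (n / 2)) := by
  obtain ⟨m, rfl⟩ := hn
  obtain ⟨m, rfl⟩ : ∃ l, m = l + 1 := ⟨m - 1, by omega⟩
  have haR : (0 : ℝ) < (a : ℝ) := by exact_mod_cast ha0
  obtain ⟨r, hr, h1⟩ := gamma_shift (a + 1 / 2) (by positivity) (m + k)
  obtain ⟨s, hs, h2⟩ := gamma_shift (2 * a) (by positivity) (2 * m + 1 + k)
  have hA : 0 < Real.Gamma ((((m + 1 + (m + 1) : ℕ) : ℝ) - 1) / 2 + (a : ℝ)) := by
    apply Real.Gamma_pos_of_pos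
    push_cast
    have : (0 : ℝ) ≤ m := Nat.cast_nonneg m
    linarith
  have e1 : ((((m + 1 + (m + 1) : ℕ) : ℝ) - 1) / 2 + (a : ℝ)) + (k : ℝ)
      = ((a + 1 / 2 : ℚ) : ℝ) + ((m + k : ℕ) : ℝ) := by push_cast; ring
  have e2 : 2 * ((((m + 1 + (m + 1) : ℕ) : ℝ) - 1) / 2 + (a : ℝ)) + (k : ℝ)
      = ((2 * a : ℚ) : ℝ) + ((2 * m + 1 + k : ℕ) : ℝ) := by push_cast; ring
  have hdup := Real.Gamma_mul_Gamma_add_half (a : ℝ)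
  rw [e1, e2, h1, h2]
  have e3 : (m + 1 + (m + 1)) / 2 = m + 1 := by omega
  have e4 : m + 1 + (m + 1) - 1 = 2 * m + 1 := by omega
  rw [e3, e4, Real.Gamma_one_half_eq]
  have c1 : ((a + 1 / 2 : ℚ) : ℝ) = (a : ℝ) + 1 / 2 := by push_cast; ring
  have c2 : ((2 * a : ℚ) : ℝ) = 2 * (a : ℝ) := by push_cast; ring
  rw [c1, c2]
  have hG : 0 < Real.Gamma (2 * (a : ℝ)) := Real.Gamma_pos_of_pos (by positivity)
  have hsR : (0 : ℝ) < (s : ℝ) := by exact_mod_cast hs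
  have hpi : (0 : ℝ) < Real.pi := Real.pi_pos
  have hsq : (√Real.pi) ^ (2 * m + 1) * √Real.pi = Real.pi ^ (m + 1) := by
    rw [← pow_succ, show 2 * m + 1 + 1 = 2 * (m + 1) by ring, pow_mul, Real.sq_sqrt hpi.le]
  generalize Real.Gamma ((((m + 1 + (m + 1) : ℕ) : ℝ) - 1) / 2 + (a : ℝ)) = G at hA
  have key : (√Real.pi ^ (2 * m + 1) * Real.Gamma (a : ℝ) / G) *
      ((r : ℝ) * Real.Gamma ((a : ℝ) + 1 / 2) * G / ((s : ℝ) * Real.Gamma (2 * (a : ℝ)))) /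
      Real.pi ^ (m + 1) = algebraMap ℚ ℝ (r / s) * (2 : ℝ) ^ ((1 - 2 * a : ℚ) : ℝ) := by
    have t : (√Real.pi ^ (2 * m + 1) * Real.Gamma (a : ℝ) / G) *
      ((r : ℝ) * Real.Gamma ((a : ℝ) + 1 / 2) * G / ((s : ℝ) * Real.Gamma (2 * (a : ℝ)))) /
      Real.pi ^ (m + 1) = √Real.pi ^ (2 * m + 1) * r *
        (Real.Gamma (a : ℝ) * Real.Gamma ((a : ℝ) + 1 / 2)) /
          (s * Real.Gamma (2 * (a : ℝ)) * Real.pi ^ (m + 1)) := by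
      field_simp
    rw [t, hdup, ← hsq]
    have hq : 0 < √Real.pi := Real.sqrt_pos.mpr hpi
    simp only [eq_ratCast]
    push_cast
    field_simp
  rw [key]
  exact (isAlgebraic_algebraMap _).mul (isAlgebraic_two_rpow _)
end

section
/- For every real number λ with 0 < λ < 2, one has 6·(λ²−λ+1)·F(2/3, −8/3, 4/3; 1−λ) − (2/3)·(λ+1)·(7λ²−10λ+7)·F(2/3, −5/3, 4/3; 1−λ) + 2·λ·(1−λ)²·F(2/3, −2/3, 4/3; 1−λ) = (2/3)·λ^{7/3}. -/
open scoped BigOperators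

/-- The Gauss hypergeometric series `F(a,b,c;z)`. -/
noncomputable def hypF (a b c z : ℝ) : ℝ :=
  ∑' n : ℕ,
    (Polynomial.eval a (ascPochhammer ℝ n) * Polynomial.eval b (ascPochhammer ℝ n) /
      (Polynomial.eval c (ascPochhammer ℝ n) * (n.factorial : ℝ))) * z ^ n


noncomputable def hc (a b c : ℝ) (n : ℕ) : ℝ :=
  (Polynomial.eval a (ascPochhammer ℝ n) * Polynomial.eval b (ascPochhammer ℝ n) /
      (Polynomial.eval c (ascPochhammer ℝ n) * (n.factorial : ℝ)))

noncomputable def wc (n : ℕ) : ℝ :=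
  Polynomial.eval (-7/3) (ascPochhammer ℝ n) / (n.factorial : ℝ)

lemma nat_ne_third (n : ℕ) (k : ℤ) (hk : k % 3 ≠ 0) : (n : ℝ) + k / 3 ≠ 0 := by
  intro h
  have h1 : ((3 * n + k : ℤ) : ℝ) = 0 := by push_cast; linarith
  have h2 : (3 * n + k : ℤ) = 0 := by exact_mod_cast h1
  omega

lemma asc_succ (a : ℝ) (n : ℕ) : Polynomial.eval a (ascPochhammer ℝ (n+1)) =
    Polynomial.eval a (ascPochhammer ℝ n) * (a + n) := by
  rw [ascPochhammer_succ_eval]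

lemma hc_zero (a b c : ℝ) : hc a b c 0 = 1 := by simp [hc]

lemma hc_succ (a b c : ℝ) (n : ℕ) :
    hc a b c (n+1) = hc a b c n * ((a + n) * (b + n) / ((c + n) * (n + 1))) := by
  unfold hc
  rw [asc_succ, asc_succ, asc_succ, Nat.factorial_succ, div_mul_div_comm]
  push_cast
  congr 1 <;> ring

lemma wc_zero : wc 0 = 1 := by simp [wc]

lemma wc_succ (n : ℕ) : wc (n+1) = wc n * ((-7/3 + n) / (n + 1)) := by
  unfold wc
  rw [asc_succ, Nat.factorial_succ, div_mul_div_comm]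
  push_cast
  congr 1; ring

lemma hyp_hasSum (b : ℝ) (k : ℤ) (hb : b = k / 3) (hk : k % 3 ≠ 0) (z : ℝ) (hz : |z| < 1) :
    HasSum (fun n => hc (2/3) b (4/3) n * z ^ n) (hypF (2/3) b (4/3) z) := by
  have hr : (ordinaryHypergeometricSeries ℝ (2/3) b (4/3)).radius = 1 := by
    apply ordinaryHypergeometricSeries_radius_eq_one
    intro n
    refine ⟨?_, ?_, ?_⟩
    · intro h; have := nat_ne_third n 2 (by norm_num); apply this; rw [h]; norm_num
    · intro h; have := nat_ne_third n k hk; apply this; rw [h, hb]; ring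
    · intro h; have := nat_ne_third n 4 (by norm_num); apply this; rw [h]; norm_num
  have hs := (ordinaryHypergeometricSeries ℝ (2/3) b (4/3)).summable (x := z) (by
    rw [hr]
    simpa [Metric.mem_eball, edist_dist, ENNReal.ofReal_lt_one] using hz)
  rw [ordinaryHypergeometricSeries_apply_eq'] at hs
  have he : (fun n => hc (2/3) b (4/3) n * z ^ n) = fun n => (((n.factorial : ℝ)⁻¹) *
      (ascPochhammer ℝ n).eval (2/3) * (ascPochhammer ℝ n).eval b *
        ((ascPochhammer ℝ n).eval (4/3))⁻¹) • z ^ n := by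
    funext n
    simp only [hc, smul_eq_mul, div_eq_mul_inv, mul_inv]
    ring
  rw [← he] at hs
  exact hs.hasSum

lemma choose_wc (n : ℕ) : Ring.choose (7/3 : ℝ) n * (-1) ^ n = wc n := by
  rw [Ring.choose_eq_smul]
  induction n with
  | zero => simp [wc]
  | succ n ih =>
    rw [wc_succ, ← ih, descPochhammer_succ_right, Polynomial.smeval_mul, Nat.factorial_succ]
    simp [Polynomial.smeval_sub, Polynomial.smeval_natCast]
    field_simp
    ring

lemma pow_hasSum (z : ℝ) (hz : |z| < 1) :
    HasSum (fun n => wc n * z ^ n) ((1 - z) ^ ((7 : ℝ)/3)) := by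
  have h := (Real.one_add_rpow_hasFPowerSeriesOnBall_zero (a := (7/3 : ℝ))).hasSum (y := -z) (by
    simpa [Metric.mem_eball, edist_dist, ENNReal.ofReal_lt_one] using hz)
  rw [zero_add, ← sub_eq_add_neg] at h
  have he : (fun n => wc n * z ^ n) =
      fun n => (binomialSeries ℝ (7/3 : ℝ) n) fun _ => -z := by
    funext n
    simp only [binomialSeries_apply, ← choose_wc, List.ofFn_const, List.prod_replicate,
      smul_eq_mul, neg_pow z]
    ring
  rw [he]
  exact h

lemma ne3 (n : ℕ) (k : ℤ) (hk : k % 3 ≠ 0) : 3 * (n : ℝ) + k ≠ 0 := by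
  intro h
  apply nat_ne_third n k hk
  linarith

lemma f1 (n : ℕ) : hc (2/3) (-8/3) (4/3) n = wc n *
    ((20/7) * (3*n-7)*(3*n-4)*(3*n-1) / ((3*n+(-8))*(3*n+(-5))*(3*n+(-2))*(3*n+(1)))) := by
  induction n with
  | zero => simp [hc_zero, wc_zero]; norm_num
  | succ n ih =>
    rw [hc_succ, wc_succ, ih]
    have h0 := ne3 n (-8) (by norm_num)
    have h1 := ne3 n (-5) (by norm_num)
    have h2 := ne3 n (-2) (by norm_num)
    have h3 := ne3 n (1) (by norm_num)
    have h4 := ne3 n (4) (by norm_num)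
    have hn : (n:ℝ) + 1 ≠ 0 := by positivity
    push_cast at h0 h1 h2 h3 h4 ⊢
    have e4 : (4/3 + (n:ℝ)) = (3*n+4)/3 := by ring
    rw [e4, show 3*((n:ℝ)+1)+(-8) = 3*n+(-5) by ring, show 3*((n:ℝ)+1)+(-5) = 3*n+(-2) by ring, show 3*((n:ℝ)+1)+(-2) = 3*n+(1) by ring, show 3*((n:ℝ)+1)+(1) = 3*n+(4) by ring]
    field_simp
    ring

lemma f2 (n : ℕ) : hc (2/3) (-5/3) (4/3) n = wc n *
    ((-5/14) * (3*n-7)*(3*n-4)*(3*n-1) / ((3*n+(-5))*(3*n+(-2))*(3*n+(1)))) := by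
  induction n with
  | zero => simp [hc_zero, wc_zero]; norm_num
  | succ n ih =>
    rw [hc_succ, wc_succ, ih]
    have h0 := ne3 n (-5) (by norm_num)
    have h1 := ne3 n (-2) (by norm_num)
    have h2 := ne3 n (1) (by norm_num)
    have h3 := ne3 n (4) (by norm_num)
    have hn : (n:ℝ) + 1 ≠ 0 := by positivity
    push_cast at h0 h1 h2 h3 ⊢
    have e4 : (4/3 + (n:ℝ)) = (3*n+4)/3 := by ring
    rw [e4, show 3*((n:ℝ)+1)+(-5) = 3*n+(-2) by ring, show 3*((n:ℝ)+1)+(-2) = 3*n+(1) by ring, show 3*((n:ℝ)+1)+(1) = 3*n+(4) by ring]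
    field_simp
    ring

lemma f3 (n : ℕ) : hc (2/3) (-2/3) (4/3) n = wc n *
    ((1/14) * (3*n-7)*(3*n-4)*(3*n-1) / ((3*n+(-2))*(3*n+(1)))) := by
  induction n with
  | zero => simp [hc_zero, wc_zero]; norm_num
  | succ n ih =>
    rw [hc_succ, wc_succ, ih]
    have h0 := ne3 n (-2) (by norm_num)
    have h1 := ne3 n (1) (by norm_num)
    have h2 := ne3 n (4) (by norm_num)
    have hn : (n:ℝ) + 1 ≠ 0 := by positivity
    push_cast at h0 h1 h2 ⊢
    have e4 : (4/3 + (n:ℝ)) = (3*n+4)/3 := by ring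
    rw [e4, show 3*((n:ℝ)+1)+(-2) = 3*n+(1) by ring, show 3*((n:ℝ)+1)+(1) = 3*n+(4) by ring]
    field_simp
    ring

lemma coeff (n : ℕ) :
    6 * (hc (2/3) (-8/3) (4/3) (n+3) - hc (2/3) (-8/3) (4/3) (n+2) + hc (2/3) (-8/3) (4/3) (n+1))
    - (2/3) * (8 * hc (2/3) (-5/3) (4/3) (n+3) - 12 * hc (2/3) (-5/3) (4/3) (n+2) + 18 * hc (2/3) (-5/3) (4/3) (n+1) - 7 * hc (2/3) (-5/3) (4/3) n)
    + 2 * (hc (2/3) (-2/3) (4/3) (n+1) - hc (2/3) (-2/3) (4/3) n) = (2/3) * wc (n+3) := by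
  simp only [f1, f2, f3]
  rw [wc_succ (n+2), wc_succ (n+1), wc_succ n]
  have h0 := ne3 n (-8) (by norm_num)
  have h1 := ne3 n (-5) (by norm_num)
  have h2 := ne3 n (-2) (by norm_num)
  have h3 := ne3 n (1) (by norm_num)
  have h4 := ne3 n (4) (by norm_num)
  have h5 := ne3 n (7) (by norm_num)
  have h6 := ne3 n (10) (by norm_num)
  have hn1 : (n:ℝ) + 1 ≠ 0 := by positivity
  have hn2 : (n:ℝ) + 2 ≠ 0 := by positivity
  have hn3 : (n:ℝ) + 3 ≠ 0 := by positivity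
  push_cast at h0 h1 h2 h3 h4 h5 h6 ⊢
  simp only [show 3*((n:ℝ)+1)+(-8) = 3*n+(-5) by ring, show 3*((n:ℝ)+1)+(-5) = 3*n+(-2) by ring, show 3*((n:ℝ)+1)+(-2) = 3*n+(1) by ring, show 3*((n:ℝ)+1)+(1) = 3*n+(4) by ring, show 3*((n:ℝ)+2)+(-8) = 3*n+(-2) by ring, show 3*((n:ℝ)+2)+(-5) = 3*n+(1) by ring, show 3*((n:ℝ)+2)+(-2) = 3*n+(4) by ring, show 3*((n:ℝ)+2)+(1) = 3*n+(7) by ring, show 3*((n:ℝ)+3)+(-8) = 3*n+(1) by ring, show 3*((n:ℝ)+3)+(-5) = 3*n+(4) by ring, show 3*((n:ℝ)+3)+(-2) = 3*n+(7) by ring, show 3*((n:ℝ)+3)+(1) = 3*n+(10) by ring, show (n:ℝ)+1+1 = n+2 by ring, show (n:ℝ)+2+1 = n+3 by ring]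
  field_simp
  ring

lemma hs_congr {f g : ℕ → ℝ} {S T : ℝ} (h : HasSum f S) (hfg : ∀ n, g n = f n) (hST : T = S) :
    HasSum g T := by
  rw [hST, funext hfg]; exact h

lemma shift0 (f : ℕ → ℝ) (z S : ℝ) (h : HasSum (fun n => f n * z ^ n) S) :
    HasSum (fun n => f (n+3) * z ^ (n+3)) (S - (f 0 + f 1 * z + f 2 * z^2)) := by
  have := (hasSum_nat_add_iff' 3).2 h
  simpa [Finset.sum_range_succ] using this

lemma shift1 (f : ℕ → ℝ) (z S : ℝ) (h : HasSum (fun n => f n * z ^ n) S) :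
    HasSum (fun n => f (n+2) * z ^ (n+3)) (z * (S - (f 0 + f 1 * z))) := by
  have := ((hasSum_nat_add_iff' 2).2 h).mul_left z
  exact hs_congr this (fun n => by ring) (by simp [Finset.sum_range_succ])

lemma shift2 (f : ℕ → ℝ) (z S : ℝ) (h : HasSum (fun n => f n * z ^ n) S) :
    HasSum (fun n => f (n+1) * z ^ (n+3)) (z^2 * (S - f 0)) := by
  have := ((hasSum_nat_add_iff' 1).2 h).mul_left (z^2)
  exact hs_congr this (fun n => by ring) (by simp [Finset.sum_range_succ])

lemma shift3 (f : ℕ → ℝ) (z S : ℝ) (h : HasSum (fun n => f n * z ^ n) S) :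
    HasSum (fun n => f n * z ^ (n+3)) (z^3 * S) := by
  have := h.mul_left (z^3)
  exact hs_congr this (fun n => by ring) rfl

theorem stmt14 (l : ℝ) (h0 : 0 < l) (h2 : l < 2) :
    6 * (l ^ 2 - l + 1) * hypF (2 / 3) (-8 / 3) (4 / 3) (1 - l)
      - (2 / 3) * (l + 1) * (7 * l ^ 2 - 10 * l + 7) * hypF (2 / 3) (-5 / 3) (4 / 3) (1 - l)
      + 2 * l * (1 - l) ^ 2 * hypF (2 / 3) (-2 / 3) (4 / 3) (1 - l)
      = (2 / 3) * l ^ ((7 : ℝ) / 3) := by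
  obtain ⟨z, rfl⟩ : ∃ z, l = 1 - z := ⟨1 - l, by ring⟩
  have hz : |z| < 1 := by rw [abs_lt]; constructor <;> linarith
  rw [sub_sub_cancel]
  have H1 := hyp_hasSum (-8/3) (-8) (by norm_num) (by norm_num) z hz
  have H2 := hyp_hasSum (-5/3) (-5) (by norm_num) (by norm_num) z hz
  have H3 := hyp_hasSum (-2/3) (-2) (by norm_num) (by norm_num) z hz
  have H4 := (shift0 _ _ _ (pow_hasSum z hz)).mul_left (2/3)
  have T := (((((shift0 _ _ _ H1).sub (shift1 _ _ _ H1)).add (shift2 _ _ _ H1)).mul_left 6).sub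
    ((((((shift0 _ _ _ H2).mul_left 8).sub ((shift1 _ _ _ H2).mul_left 12)).add
      ((shift2 _ _ _ H2).mul_left 18)).sub ((shift3 _ _ _ H2).mul_left 7)).mul_left (2/3))).add
    (((shift2 _ _ _ H3).sub (shift3 _ _ _ H3)).mul_left 2)
  have E := H4.unique (hs_congr T (fun n => by
    rw [← mul_assoc, ← coeff]
    ring) rfl)
  simp only [show (2:ℕ) = 1 + 1 from rfl, show hc (2/3) (-8/3) (4/3) 1 = hc (2/3) (-8/3) (4/3) (0+1) from rfl, show hc (2/3) (-5/3) (4/3) 1 = hc (2/3) (-5/3) (4/3) (0+1) from rfl, show wc 1 = wc (0+1) from rfl, hc_succ, wc_succ, hc_zero, wc_zero] at E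
  norm_num at E ⊢
  linear_combination -E
end

section
/- For every real number λ with λ > 1, one has (3/5)·(λ²−λ+1)·F(7/3, −1/3, 11/3; 1/λ) − (2/15)·(λ+1)·(5λ²−8λ+5)·F(4/3, −1/3, 8/3; 1/λ) = −(2/3)·(λ−1)^{5/3}·λ^{4/3}. -/
open scoped BigOperators

/-- Coefficients of the hypergeometric series. -/
noncomputable def hypC (a b c : ℝ) (n : ℕ) : ℝ :=
  (Polynomial.eval a (ascPochhammer ℝ n) * Polynomial.eval b (ascPochhammer ℝ n) /
      (Polynomial.eval c (ascPochhammer ℝ n) * (n.factorial : ℝ)))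

lemma hypC_zero (a b c : ℝ) : hypC a b c 0 = 1 := by simp [hypC]

lemma hypC_succ (a b c : ℝ) (n : ℕ) :
    hypC a b c (n + 1) = hypC a b c n * ((a + n) * (b + n) / ((c + n) * (n + 1))) := by
  simp only [hypC, ascPochhammer_succ_eval, Nat.factorial_succ]
  push_cast
  rw [div_mul_div_comm]
  congr 1 <;> ring

lemma hypF_hasSum (a b c z : ℝ) (hz : |z| < 1)
    (H : ∀ n : ℕ, |(a + n) * (b + n) / ((c + n) * (n + 1))| ≤ 1) :
    HasSum (fun n => hypC a b c n * z ^ n) (hypF a b c z) := by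
  have hb : ∀ n, |hypC a b c n| ≤ 1 := by
    intro n
    induction n with
    | zero => simp [hypC_zero]
    | succ n ih =>
      rw [hypC_succ, abs_mul]
      exact mul_le_one₀ ih (abs_nonneg _) (H n)
  have hs : Summable (fun n => hypC a b c n * z ^ n) := by
    refine Summable.of_norm_bounded (summable_geometric_of_lt_one (abs_nonneg z) hz) ?_
    intro n
    rw [Real.norm_eq_abs, abs_mul, abs_pow]
    exact mul_le_of_le_one_left (by positivity) (hb n)
  exact hs.hasSum

/-- Binomial coefficients with sign. -/
noncomputable def binC (n : ℕ) : ℝ := Ring.choose (5 / 3 : ℝ) n * (-1) ^ n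

lemma binC_zero : binC 0 = 1 := by simp [binC]

lemma binC_succ (n : ℕ) : binC (n + 1) = binC n * ((n - 5 / 3) / (n + 1)) := by
  simp only [binC, Ring.choose_eq_smul, descPochhammer_succ_right, Polynomial.smeval_mul,
    Polynomial.smeval_sub, Polynomial.smeval_X, Polynomial.smeval_natCast, Nat.factorial_succ,
    smul_eq_mul]
  have : (n.factorial : ℝ) ≠ 0 := by positivity
  have : (n + 1 : ℝ) ≠ 0 := by positivity
  push_cast
  simp
  field_simp
  ring

lemma binC_hasSum (z : ℝ) (hz : |z| < 1) :
    HasSum (fun n => binC n * z ^ n) ((1 - z) ^ ((5 : ℝ) / 3)) := by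
  have hm : -z ∈ Metric.eball (0 : ℝ) 1 := by
    rw [← ENNReal.ofReal_one, Metric.eball_ofReal]
    simpa using hz
  have h := (Real.one_add_rpow_hasFPowerSeriesOnBall_zero (a := 5 / 3)).hasSum hm
  simp only [binomialSeries_apply, List.ofFn_const, List.prod_replicate, smul_eq_mul,
    ← sub_eq_add_neg] at h
  have e : (fun n => binC n * z ^ n) = fun n => Ring.choose (5 / 3 : ℝ) n * (-z) ^ n := by
    funext n
    rw [binC, neg_pow z]
    ring
  rw [e]
  rwa [zero_sub, ← sub_eq_add_neg] at h

lemma key (h g p : ℕ → ℝ) (h0 : h 0 = 1) (g0 : g 0 = 1) (p0 : p 0 = 1)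
    (hh : ∀ n : ℕ, h (n + 1) = h n * ((4 / 3 + n) * (-1 / 3 + n) / ((8 / 3 + n) * (n + 1))))
    (hg : ∀ n : ℕ, g (n + 1) = g n * ((7 / 3 + n) * (-1 / 3 + n) / ((11 / 3 + n) * (n + 1))))
    (hp : ∀ n : ℕ, p (n + 1) = p n * ((n - 5 / 3) / (n + 1))) (n : ℕ) :
    (3 / 5) * (g (n + 2) - g (n + 1) + g n)
      - (2 / 15) * (5 * h (n + 3) - 3 * h (n + 2) - 3 * h (n + 1) + 5 * h n)
      = -(2 / 3) * p (n + 3) := by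
  have A : ∀ n : ℕ, g n = h n * (2 * (3 * n + 4) / (3 * n + 8)) := by
    intro n
    induction n with
    | zero => rw [h0, g0]; norm_num
    | succ n ih =>
      rw [hg, hh, ih]
      push_cast
      field_simp
      ring
  have B : ∀ n : ℕ, p (n + 3) = -h n * ((3 * n - 1) * (3 * n + 2) * (3 * n + 5) /
      (27 * (n + 1) * (n + 2) * (n + 3))) := by
    intro n
    induction n with
    | zero => rw [hp, hp, hp, h0, p0]; norm_num
    | succ n ih =>
      rw [show n + 1 + 3 = n + 3 + 1 by ring, hp, ih, hh]
      push_cast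
      field_simp
      ring
  rw [A, A, A, B, hh (n + 2), hh (n + 1), hh n]
  push_cast
  field_simp
  ring

lemma hasSum_unique_of_eq {f g : ℕ → ℝ} {a b : ℝ} (hf : HasSum f a) (hg : HasSum g b)
    (h : ∀ n, f n = g n) : a = b := by
  have e : f = g := funext h
  subst e
  exact hf.unique hg

lemma ident (z : ℝ) (hz : |z| < 1) :
    (3 / 5) * z * (1 - z + z ^ 2) * hypF (7 / 3) (-1 / 3) (11 / 3) z
      - (2 / 15) * (5 - 3 * z - 3 * z ^ 2 + 5 * z ^ 3) * hypF (4 / 3) (-1 / 3) (8 / 3) z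
      = -(2 / 3) * (1 - z) ^ ((5 : ℝ) / 3) := by
  have Hh := hypF_hasSum (4 / 3) (-1 / 3) (8 / 3) z hz (by
    intro n
    rw [abs_le, div_le_one (by positivity), le_div_iff₀ (by positivity)]
    have : (0 : ℝ) ≤ n := by positivity
    constructor <;> nlinarith)
  have Hg := hypF_hasSum (7 / 3) (-1 / 3) (11 / 3) z hz (by
    intro n
    rw [abs_le, div_le_one (by positivity), le_div_iff₀ (by positivity)]
    have : (0 : ℝ) ≤ n := by positivity
    constructor <;> nlinarith)
  have Hp := binC_hasSum z hz
  have K := key (hypC (4 / 3) (-1 / 3) (8 / 3)) (hypC (7 / 3) (-1 / 3) (11 / 3)) binC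
    (hypC_zero _ _ _) (hypC_zero _ _ _) binC_zero (hypC_succ _ _ _) (hypC_succ _ _ _) binC_succ
  have h1 : hypC (4 / 3) (-1 / 3) (8 / 3) 1 = -(1 / 6) := by
    rw [hypC_succ, hypC_zero]; norm_num
  have h2 : hypC (4 / 3) (-1 / 3) (8 / 3) 2 = -(7 / 198) := by
    rw [hypC_succ, h1]; norm_num
  have g1 : hypC (7 / 3) (-1 / 3) (11 / 3) 1 = -(7 / 33) := by
    rw [hypC_succ, hypC_zero]; norm_num
  have p1 : binC 1 = -(5 / 3) := by
    rw [binC_succ, binC_zero]; norm_num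
  have p2 : binC 2 = 5 / 9 := by
    rw [binC_succ, p1]; norm_num
  have hs3 := (hasSum_nat_add_iff' 3).2 Hh
  have hs2 := (hasSum_nat_add_iff' 2).2 Hh
  have hs1 := (hasSum_nat_add_iff' 1).2 Hh
  have gs2 := (hasSum_nat_add_iff' 2).2 Hg
  have gs1 := (hasSum_nat_add_iff' 1).2 Hg
  have ps3 := (hasSum_nat_add_iff' 3).2 Hp
  have L := (((gs2.mul_left z).sub (gs1.mul_left (z ^ 2))).add (Hg.mul_left (z ^ 3))).mul_left (3 / 5)
  have M := ((((hs3.mul_left 5).sub (hs2.mul_left (3 * z))).sub (hs1.mul_left (3 * z ^ 2))).add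
    (Hh.mul_left (5 * z ^ 3))).mul_left (2 / 15)
  have R := ps3.mul_left (-(2 / 3))
  have LM := L.sub M
  have E := hasSum_unique_of_eq LM R (fun n => by linear_combination z ^ (n + 3) * K n)
  simp only [Finset.sum_range_succ, Finset.sum_range_zero, hypC_zero, binC_zero, h1, h2, g1, p1,
      p2] at E
  linear_combination E

theorem stmt16 (l : ℝ) (h1 : 1 < l) :
    (3 / 5) * (l ^ 2 - l + 1) * hypF (7 / 3) (-1 / 3) (11 / 3) (1 / l)
      - (2 / 15) * (l + 1) * (5 * l ^ 2 - 8 * l + 5) * hypF (4 / 3) (-1 / 3) (8 / 3) (1 / l)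
      = -(2 / 3) * (l - 1) ^ ((5 : ℝ) / 3) * l ^ ((4 : ℝ) / 3) := by
  have hl : 0 < l := by linarith
  have hz : |1 / l| < 1 := by
    rw [abs_of_pos (by positivity), div_lt_one hl]; exact h1
  have h := ident (1 / l) hz
  have e : (l - 1) ^ ((5 : ℝ) / 3) * l ^ ((4 : ℝ) / 3) = l ^ 3 * (1 - 1 / l) ^ ((5 : ℝ) / 3) := by
    rw [show 1 - 1 / l = (l - 1) / l by field_simp, Real.div_rpow (by linarith) hl.le,
      ← Real.rpow_natCast l 3, show ((3 : ℕ) : ℝ) = 5 / 3 + 4 / 3 by norm_num, Real.rpow_add hl]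
    have : l ^ ((5 : ℝ) / 3) ≠ 0 := by positivity
    field_simp
  rw [mul_assoc (-(2 / 3) : ℝ), e]
  generalize hypF (7 / 3) (-1 / 3) (11 / 3) (1 / l) = G at *
  generalize hypF (4 / 3) (-1 / 3) (8 / 3) (1 / l) = H at *
  generalize (1 - 1 / l) ^ ((5 : ℝ) / 3) = P at *
  have e2 : l * (1 / l) = 1 := by field_simp
  generalize 1 / l = z at *
  have e3 : z = l⁻¹ := by field_simp; linarith
  subst e3
  field_simp at h
  field_simp
  linarith
end

section
/- The function λ ↦ F(4/3, −4/3, 8/3; 1−λ) on the interval (0,2) is not algebraic over the field of rational functions: for every nonzero polynomial P ∈ ℂ[X,Y] there exists a real number λ with 0 < λ < 2 such that P(λ, F(4/3, −4/3, 8/3; 1−λ)) ≠ 0. -/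
open scoped BigOperators

open Polynomial in
/-- Existence of an annihilating polynomial which is separable at `f`. -/
lemma exists_sep (f : PowerSeries ℚ) (Q0 : ℚ[X][X]) (h0 : Q0 ≠ 0)
    (hQ0 : eval₂ (coeToPowerSeries.ringHom (R := ℚ)) f Q0 = 0) :
    ∃ Q : ℚ[X][X], eval₂ (coeToPowerSeries.ringHom (R := ℚ)) f Q = 0 ∧
      eval₂ (coeToPowerSeries.ringHom (R := ℚ)) f (derivative Q) ≠ 0 := by
  induction hd : Q0.natDegree using Nat.strong_induction_on generalizing Q0 with
  | _ d ih =>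
    by_cases hder : eval₂ (coeToPowerSeries.ringHom (R := ℚ)) f (derivative Q0) = 0
    · have hne : Q0.natDegree ≠ 0 := by
        intro h
        rw [Polynomial.eq_C_of_natDegree_eq_zero h] at hQ0 h0
        rw [eval₂_C] at hQ0
        apply h0
        have : Q0.coeff 0 = 0 := Polynomial.coe_injective ℚ (by simpa using hQ0)
        rw [this, C_0]
      refine ih _ (hd ▸ natDegree_derivative_lt hne) (derivative Q0) ?_ hder rfl
      intro h
      exact hne (derivative_eq_zero.1 h)
    · exact ⟨Q0, hQ0, hder⟩

open Polynomial in
/-- Integrality propagation (Eisenstein). -/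
lemma integ (R : Subring ℚ) (f : PowerSeries ℚ) (Q : ℚ[X][X])
    (hQ : eval₂ (coeToPowerSeries.ringHom (R := ℚ)) f Q = 0) (m : ℕ) (u : PowerSeries ℚ)
    (hder : eval₂ (coeToPowerSeries.ringHom (R := ℚ)) f (derivative Q) = PowerSeries.X ^ m * u)
    (hu : PowerSeries.coeff 0 u ≠ 0) (hu' : (PowerSeries.coeff 0 u)⁻¹ ∈ R)
    (hc : ∀ i j, (Q.coeff i).coeff j ∈ R)
    (hf : ∀ n ≤ m, PowerSeries.coeff n f ∈ R) (n : ℕ) : PowerSeries.coeff n f ∈ R := by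
  have hT : ∀ g : PowerSeries ℚ, g ∈ (PowerSeries.map R.subtype).range ↔
      ∀ n, PowerSeries.coeff n g ∈ R := by
    intro g
    constructor
    · rintro ⟨g', rfl⟩ n
      simp
    · intro h
      exact ⟨PowerSeries.mk fun n => ⟨_, h n⟩, by ext n; simp⟩
  induction n using Nat.strong_induction_on with
  | _ n ih =>
    rcases le_or_gt n m with hn | hn
    · exact hf n hn
    set g : PowerSeries ℚ := ((PowerSeries.trunc n f : ℚ[X]) : PowerSeries ℚ) with hg
    set h : PowerSeries ℚ := PowerSeries.mk fun i => PowerSeries.coeff (i + n) f with hh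
    have hfg : f = PowerSeries.X ^ n * h + g := PowerSeries.eq_X_pow_mul_shift_add_trunc n f
    have hgT : g ∈ (PowerSeries.map R.subtype).range := by
      rw [hT]
      intro k
      rw [hg, Polynomial.coeff_coe, PowerSeries.coeff_trunc]
      split_ifs with hk
      · exact ih k hk
      · exact R.zero_mem
    have hev : eval₂ (coeToPowerSeries.ringHom (R := ℚ)) g Q ∈
        (PowerSeries.map R.subtype).range := by
      rw [eval₂_eq_sum_range]
      refine Subring.sum_mem _ fun i _ => Subring.mul_mem _ ?_ (Subring.pow_mem _ hgT _)
      rw [hT]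
      intro j
      simpa using hc i j
    obtain ⟨k, hk⟩ := Polynomial.binomExpansion
      (Q.map (coeToPowerSeries.ringHom (R := ℚ))) f (-(PowerSeries.X ^ n * h))
    have hfg' : f + -(PowerSeries.X ^ n * h) = g := by
      rw [hfg]; ring
    rw [hfg', eval_map, eval_map, derivative_map, eval_map, hQ, hder] at hk
    have hk2 : eval₂ (coeToPowerSeries.ringHom (R := ℚ)) g Q =
        PowerSeries.X ^ (n + m) * (-(u * h) + PowerSeries.X * (PowerSeries.X ^ (n - m - 1) * (k * h ^ 2))) := by
      rw [hk]
      have : (PowerSeries.X : PowerSeries ℚ) ^ n = PowerSeries.X ^ m * (PowerSeries.X * PowerSeries.X ^ (n - m - 1)) := by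
        rw [← pow_succ', ← pow_add]; congr 1; omega
      rw [pow_add, this]; ring
    have hco := (hT _).1 hev (n + m)
    rw [hk2, PowerSeries.coeff_X_pow_mul'] at hco
    simp [hh] at hco
    have := R.mul_mem hu' hco
    simp only [PowerSeries.coeff_zero_eq_constantCoeff] at *
    rwa [inv_mul_cancel_left₀ hu] at this

lemma ev_int (x : ℚ) : ∀ᶠ p : ℕ in Filter.atTop, ¬ p ∣ x.den := by
  filter_upwards [Filter.eventually_gt_atTop x.den] with p hp h
  exact absurd (Nat.le_of_dvd x.den_pos h) (by omega)

open Polynomial in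
lemma eisenstein (f : PowerSeries ℚ) (Q0 : ℚ[X][X]) (h0 : Q0 ≠ 0)
    (hQ0 : eval₂ (coeToPowerSeries.ringHom (R := ℚ)) f Q0 = 0) :
    ∀ᶠ p : ℕ in Filter.atTop, ∀ _ : Fact p.Prime, ∀ n,
      ‖((PowerSeries.coeff n f : ℚ) : ℚ_[p])‖ ≤ 1 := by
  obtain ⟨Q, hQ, hder⟩ := exists_sep f Q0 h0 hQ0
  set D := eval₂ (coeToPowerSeries.ringHom (R := ℚ)) f (derivative Q) with hD
  have h1 : ∀ᶠ p : ℕ in Filter.atTop, ∀ i ∈ Finset.range (Q.natDegree + 1),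
      ∀ j ∈ Finset.range ((Q.coeff i).natDegree + 1), ¬ p ∣ ((Q.coeff i).coeff j).den := by
    rw [Filter.eventually_all_finset]
    intro i _
    rw [Filter.eventually_all_finset]
    intro j _
    exact ev_int _
  have h2 : ∀ᶠ p : ℕ in Filter.atTop, ∀ i ∈ Finset.range (D.order.toNat + 1),
      ¬ p ∣ (PowerSeries.coeff i f).den := by
    rw [Filter.eventually_all_finset]
    intro i _
    exact ev_int _
  filter_upwards [h1, h2, ev_int ((PowerSeries.coeff 0 D.divXPowOrder)⁻¹)] with p h1 h2 h3 hp n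
  have key := integ ((PadicInt.subring p).comap (Rat.castHom ℚ_[p])) f Q hQ D.order.toNat
    D.divXPowOrder PowerSeries.X_pow_order_mul_divXPowOrder.symm
    (by simpa using PowerSeries.coeff_order hder)
    (Padic.norm_rat_le_one h3) ?_ ?_ n
  · exact key
  · intro i j
    apply Padic.norm_rat_le_one
    by_cases hi : i < Q.natDegree + 1
    · by_cases hj : j < (Q.coeff i).natDegree + 1
      · exact h1 i (Finset.mem_range.2 hi) j (Finset.mem_range.2 hj)
      · rw [coeff_eq_zero_of_natDegree_lt (by omega : (Q.coeff i).natDegree < j)]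
        simpa using hp.out.one_lt.ne'
    · rw [coeff_eq_zero_of_natDegree_lt (by omega : Q.natDegree < i)]
      simpa using hp.out.one_lt.ne'
  · intro i hi
    exact Padic.norm_rat_le_one (h2 i (Finset.mem_range.2 (by omega)))

/-- The coefficients. -/
def aq (n : ℕ) : ℚ := ∏ k ∈ Finset.range n, ((3 * k + 4 : ℚ) * (3 * k - 4) / ((3 * k + 8) * (3 * k + 3)))

lemma aq_bad (n p : ℕ) [hp : Fact p.Prime] (hn : 0 < n) (hpn : p = 3 * n + 5) :
    ¬ ‖((aq n : ℚ) : ℚ_[p])‖ ≤ 1 := by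
  intro hle
  set A : ℤ := ∏ k ∈ Finset.range n, ((3 * k + 4 : ℤ) * (3 * k - 4)) with hA
  set B : ℤ := ∏ k ∈ Finset.range n, ((3 * k + 8 : ℤ) * (3 * k + 3)) with hB
  have hAB : aq n * B = A := by
    rw [hA, hB, aq]
    push_cast
    rw [← Finset.prod_mul_distrib]
    refine Finset.prod_congr rfl fun k _ => ?_
    have : ((3 * k + 8 : ℚ) * (3 * k + 3)) ≠ 0 := by positivity
    field_simp
  have hpB : (p : ℤ) ∣ B := by
    have : n - 1 ∈ Finset.range n := Finset.mem_range.2 (by omega)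
    refine dvd_trans ?_ (Finset.dvd_prod_of_mem _ this)
    refine Dvd.intro (3 * ((n - 1 : ℕ) : ℤ) + 3) ?_
    congr 1
    omega
  have hpA : ¬ (p : ℤ) ∣ A := by
    intro h
    have hpp : Prime (p : ℤ) := Nat.prime_iff_prime_int.1 hp.out
    obtain ⟨k, hk, hd⟩ := (hpp.dvd_finsetProd_iff _).1 h
    rw [Finset.mem_range] at hk
    rcases hpp.dvd_or_dvd hd with h | h
    · have := Int.le_of_dvd (by omega) h
      omega
    · rcases lt_trichotomy (3 * (k : ℤ) - 4) 0 with h0 | h0 | h0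
      · rw [← dvd_neg] at h
        have := Int.le_of_dvd (by omega) h
        omega
      · omega
      · have := Int.le_of_dvd (by omega) h
        omega
  have h1 : ‖((B : ℤ) : ℚ_[p])‖ < 1 := (Padic.norm_intCast_lt_one_iff).2 hpB
  apply hpA
  rw [← Padic.norm_intCast_lt_one_iff]
  have : ((A : ℤ) : ℚ_[p]) = (aq n : ℚ_[p]) * (B : ℚ_[p]) := by
    exact_mod_cast (congrArg (fun x : ℚ => (x : ℚ_[p])) hAB).symm
  rw [this, norm_mul]
  calc _ ≤ 1 * ‖((B : ℤ) : ℚ_[p])‖ := by gcongr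
    _ < 1 := by simpa using h1

open Polynomial in
lemma transc (Q0 : ℚ[X][X]) (h0 : Q0 ≠ 0) :
    eval₂ (coeToPowerSeries.ringHom (R := ℚ)) (PowerSeries.mk aq) Q0 ≠ 0 := by
  intro hQ0
  obtain ⟨N, hN⟩ := Filter.eventually_atTop.1 (eisenstein _ Q0 h0 hQ0)
  obtain ⟨p, hpN, hp, hp2⟩ := Nat.forall_exists_prime_gt_and_eq_mod (q := 3) (a := 2) (by decide) (N + 5)
  have : Fact p.Prime := ⟨hp⟩
  have hmod : p % 3 = 2 := by
    have := (ZMod.natCast_eq_natCast_iff' p 2 3).1 (by exact_mod_cast hp2)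
    omega
  refine aq_bad ((p - 5) / 3) p (by omega) (by omega) ?_
  have := hN p (by omega) ⟨hp⟩ ((p - 5) / 3)
  simpa using this
/-- `g` converges absolutely to `F` on `(-1,1)`. -/
def CvRep (g : PowerSeries ℂ) (F : ℝ → ℂ) : Prop := ∀ z : ℝ, |z| < 1 →
  Summable (fun n => ‖PowerSeries.coeff n g * (z : ℂ) ^ n‖) ∧
    ∑' n, PowerSeries.coeff n g * (z : ℂ) ^ n = F z

lemma CvRep.add {g h : PowerSeries ℂ} {F G : ℝ → ℂ} (hg : CvRep g F) (hh : CvRep h G) :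
    CvRep (g + h) (fun z => F z + G z) := by
  intro z hz
  obtain ⟨s1, e1⟩ := hg z hz
  obtain ⟨s2, e2⟩ := hh z hz
  simp only [map_add, add_mul]
  refine ⟨Summable.of_nonneg_of_le (fun _ => norm_nonneg _) (fun _ => norm_add_le _ _) (s1.add s2), ?_⟩
  rw [s1.of_norm.tsum_add s2.of_norm, e1, e2]

lemma CvRep.mul {g h : PowerSeries ℂ} {F G : ℝ → ℂ} (hg : CvRep g F) (hh : CvRep h G) :
    CvRep (g * h) (fun z => F z * G z) := by
  intro z hz
  obtain ⟨s1, e1⟩ := hg z hz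
  obtain ⟨s2, e2⟩ := hh z hz
  have this : (fun n => PowerSeries.coeff n (g * h) * (z : ℂ) ^ n) = fun n =>
      ∑ kl ∈ Finset.HasAntidiagonal.antidiagonal n, (PowerSeries.coeff kl.1 g * (z : ℂ) ^ kl.1) *
        (PowerSeries.coeff kl.2 h * (z : ℂ) ^ kl.2) := by
    funext n
    rw [PowerSeries.coeff_mul, Finset.sum_mul]
    refine Finset.sum_congr rfl fun kl hkl => ?_
    rw [← Finset.HasAntidiagonal.mem_antidiagonal.1 hkl, pow_add]; ring
  constructor
  · have h1 := summable_norm_sum_mul_antidiagonal_of_summable_norm s1 s2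
    have h2 := congrArg (fun (u : ℕ → ℂ) => fun n => ‖u n‖) this
    beta_reduce at h2
    rw [h2]
    exact h1
  · rw [this, ← tsum_mul_tsum_eq_tsum_sum_antidiagonal_of_summable_norm s1 s2, e1, e2]

lemma CvRep.poly (p : Polynomial ℂ) : CvRep (p : PowerSeries ℂ) (fun z => p.eval (z : ℂ)) := by
  intro z hz
  have h0 : ∀ n ∉ Finset.range (p.natDegree + 1),
      PowerSeries.coeff n (p : PowerSeries ℂ) * (z : ℂ) ^ n = 0 := by
    intro n hn
    rw [Finset.mem_range] at hn
    rw [Polynomial.coeff_coe, Polynomial.coeff_eq_zero_of_natDegree_lt (by omega), zero_mul]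
  refine ⟨summable_of_ne_finset_zero (s := Finset.range (p.natDegree + 1))
    (fun n hn => by rw [h0 n hn, norm_zero]), ?_⟩
  rw [tsum_eq_sum h0]
  beta_reduce
  rw [Polynomial.eval_eq_sum_range]
  simp

lemma CvRep.pow {g : PowerSeries ℂ} {F : ℝ → ℂ} (hg : CvRep g F) (k : ℕ) :
    CvRep (g ^ k) (fun z => F z ^ k) := by
  induction k with
  | zero => simpa using CvRep.poly 1
  | succ k ih => simpa only [pow_succ] using ih.mul hg

lemma CvRep.sum {ι : Type} (s : Finset ι) {g : ι → PowerSeries ℂ} {F : ι → ℝ → ℂ}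
    (hg : ∀ i ∈ s, CvRep (g i) (F i)) : CvRep (∑ i ∈ s, g i) (fun z => ∑ i ∈ s, F i z) := by
  classical
  induction s using Finset.induction_on with
  | empty => simpa using CvRep.poly 0
  | insert a s ha ih =>
    simp only [Finset.sum_insert ha]
    exact (hg a (by simp)).add (ih fun i hi => hg i (by simp [hi]))

lemma CvRep.eq_zero {g : PowerSeries ℂ} {F : ℝ → ℂ} (hg : CvRep g F) (hF : ∀ z : ℝ, |z| < 1 → F z = 0) :
    g = 0 := by
  let p : FormalMultilinearSeries ℝ ℝ ℂ :=
    fun n => ContinuousMultilinearMap.mkPiRing ℝ (Fin n) (PowerSeries.coeff n g)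
  have hpc : ∀ n, p.coeff n = PowerSeries.coeff n g := by
    intro n
    simp [p, FormalMultilinearSeries.coeff]
  have h : HasFPowerSeriesAt (0 : ℝ → ℂ) p 0 := by
    rw [hasFPowerSeriesAt_iff]
    filter_upwards [Metric.ball_mem_nhds (0 : ℝ) one_pos] with z hz
    have hz' : |z| < 1 := by simpa using hz
    obtain ⟨s, e⟩ := hg z hz'
    rw [hF z hz'] at e
    have := s.of_norm.hasSum
    rw [e] at this
    have h00 : (0 : ℝ → ℂ) (0 + z) = 0 := rfl
    rw [h00]
    convert this using 2 with n
    rw [hpc, Complex.real_smul]; push_cast; ring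
  ext n
  rw [← hpc, h.eq_zero]
  simp [FormalMultilinearSeries.coeff]

lemma coef_eq (n : ℕ) : Polynomial.eval (4 / 3 : ℝ) (ascPochhammer ℝ n) * Polynomial.eval (-4 / 3) (ascPochhammer ℝ n) /
      (Polynomial.eval (8 / 3) (ascPochhammer ℝ n) * (n.factorial : ℝ)) = ((aq n : ℚ) : ℝ) := by
  induction n with
  | zero => simp [aq]
  | succ n ih =>
    rw [aq, Finset.prod_range_succ, ← aq]
    push_cast
    rw [← ih]
    simp only [ascPochhammer_succ_eval, Nat.factorial_succ]
    push_cast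
    have h1 : Polynomial.eval (8 / 3 : ℝ) (ascPochhammer ℝ n) ≠ 0 := (ascPochhammer_pos n _ (by norm_num)).ne'
    have h2 : (n.factorial : ℝ) ≠ 0 := by positivity
    have h3 : (8 / 3 + n : ℝ) ≠ 0 := by positivity
    have h4 : (3 * n + 8 : ℝ) ≠ 0 := by positivity
    have h5 : (n + 1 : ℝ) ≠ 0 := by positivity
    have h6 : (3 * n + 3 : ℝ) ≠ 0 := by positivity
    rw [div_mul_div_comm, div_eq_div_iff (by positivity) (by positivity)]
    ring

lemma aq_le (n : ℕ) : |aq n| ≤ 1 := by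
  rw [aq, Finset.abs_prod]
  refine Finset.prod_le_one (fun _ _ => abs_nonneg _) fun k _ => ?_
  have : (0 : ℚ) < (3 * k + 8) * (3 * k + 3) := by positivity
  have hk : (0 : ℚ) ≤ k := by positivity
  rw [abs_div, abs_of_pos this, div_le_one this, abs_le]
  constructor <;> nlinarith

lemma rep_f : CvRep (PowerSeries.map (Rat.castHom ℂ) (PowerSeries.mk aq))
    (fun z => ((hypF (4 / 3) (-4 / 3) (8 / 3) z : ℝ) : ℂ)) := by
  intro z hz
  constructor
  · refine Summable.of_nonneg_of_le (fun _ => norm_nonneg _) (fun n => ?_)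
      (summable_geometric_of_abs_lt_one (r := |z|) (by simpa using hz))
    have h := aq_le n
    have h' : |((aq n : ℚ) : ℝ)| ≤ 1 := by exact_mod_cast h
    have h'' : ‖((aq n : ℚ) : ℂ)‖ ≤ 1 := by
      have : ((aq n : ℚ) : ℂ) = (((aq n : ℚ) : ℝ) : ℂ) := by push_cast; rfl
      rw [this, Complex.norm_real]; exact h'
    simp only [PowerSeries.coeff_map, PowerSeries.coeff_mk, Rat.coe_castHom, norm_mul, norm_pow,
      Complex.norm_real, Real.norm_eq_abs]
    exact mul_le_of_le_one_left (by positivity) h''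
  · simp only [hypF, coef_eq]
    rw [Complex.ofReal_tsum]
    simp

theorem stmt19 (P : MvPolynomial (Fin 2) ℂ) (hP : P ≠ 0) :
    ∃ l : ℝ, 0 < l ∧ l < 2 ∧
      MvPolynomial.eval ![(l : ℂ), ((hypF (4 / 3) (-4 / 3) (8 / 3) (1 - l) : ℝ) : ℂ)] P ≠ 0 := by
  by_contra! hcon
  set f : PowerSeries ℚ := PowerSeries.mk aq with hf
  -- the formal identity over ℂ
  have hG : ∑ d ∈ P.support, ((Polynomial.C (P.coeff d) : Polynomial ℂ) : PowerSeries ℂ) *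
      ((((1 - Polynomial.X : Polynomial ℂ) : PowerSeries ℂ)) ^ (d 0) *
        (PowerSeries.map (Rat.castHom ℂ) f) ^ (d 1)) = 0 := by
    refine CvRep.eq_zero (CvRep.sum P.support fun d _ =>
      (CvRep.poly (Polynomial.C (P.coeff d))).mul (((CvRep.poly (1 - Polynomial.X)).pow (d 0)).mul
        (rep_f.pow (d 1)))) ?_
    intro z hz
    rw [abs_lt] at hz
    have := hcon (1 - z) (by linarith) (by linarith)
    rw [MvPolynomial.eval_eq'] at this
    simpa using this
  obtain ⟨d0, hd0⟩ := MvPolynomial.ne_zero_iff.1 hP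
  obtain ⟨φ, hφ⟩ : ∃ φ : Module.Dual ℚ ℂ, φ (P.coeff d0) ≠ 0 := by
    by_contra! h
    exact hd0 ((Module.forall_dual_apply_eq_zero_iff ℚ _).1 h)
  -- descend to ℚ
  have hGQ : ∑ d ∈ P.support, PowerSeries.C (φ (P.coeff d)) *
      ((1 - PowerSeries.X : PowerSeries ℚ) ^ (d 0) * f ^ (d 1)) = 0 := by
    ext n
    have h1 := congrArg (fun g => φ (PowerSeries.coeff n g)) hG
    simp only [map_sum, map_zero] at h1 ⊢
    rw [← h1]
    refine Finset.sum_congr rfl fun d _ => ?_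
    have : ((((1 - Polynomial.X : Polynomial ℂ) : PowerSeries ℂ)) ^ (d 0) *
        (PowerSeries.map (Rat.castHom ℂ) f) ^ (d 1)) = PowerSeries.map (Rat.castHom ℂ)
          ((1 - PowerSeries.X : PowerSeries ℚ) ^ (d 0) * f ^ (d 1)) := by
      simp
    rw [this, Polynomial.coe_C, PowerSeries.coeff_C_mul, PowerSeries.coeff_C_mul, PowerSeries.coeff_map,
      Rat.coe_castHom, mul_comm (P.coeff d), ← Rat.smul_def, map_smul, smul_eq_mul, mul_comm]
  let P' : MvPolynomial (Fin 2) ℚ := ∑ d ∈ P.support, MvPolynomial.monomial d (φ (P.coeff d))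
  have hP' : P' ≠ 0 := by
    intro h
    have h1 := congrArg (MvPolynomial.coeff d0) h
    simp only [P', MvPolynomial.coeff_sum, MvPolynomial.coeff_monomial, MvPolynomial.coeff_zero] at h1
    rw [Finset.sum_ite_eq' P.support d0] at h1
    rw [if_pos (MvPolynomial.mem_support_iff.2 hd0)] at h1
    exact hφ h1
  let Ψ : MvPolynomial (Fin 2) ℚ →ₐ[ℚ] Polynomial (Polynomial ℚ) :=
    MvPolynomial.aeval ![Polynomial.C (1 - Polynomial.X), Polynomial.X]
  let Θ : Polynomial (Polynomial ℚ) →+* MvPolynomial (Fin 2) ℚ :=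
    Polynomial.eval₂RingHom
      (Polynomial.aeval (1 - MvPolynomial.X 0 : MvPolynomial (Fin 2) ℚ) :
        Polynomial ℚ →ₐ[ℚ] MvPolynomial (Fin 2) ℚ).toRingHom (MvPolynomial.X 1)
  have hΘ : Θ.comp Ψ.toRingHom = RingHom.id _ := by
    apply MvPolynomial.ringHom_ext
    · intro r
      simp [Θ, Ψ]
    · intro i
      fin_cases i <;> simp [Θ, Ψ]
  have hΨ : Ψ P' ≠ 0 := by
    intro h
    apply hP'
    have := RingHom.congr_fun hΘ P'
    simpa [h] using this.symm
  refine transc (Ψ P') hΨ ?_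
  rw [← hf, ← Polynomial.coe_eval₂RingHom, ← hGQ]
  simp only [P', map_sum]
  refine Finset.sum_congr rfl fun d _ => ?_
  simp only [Ψ, MvPolynomial.aeval_monomial]
  rw [Finsupp.prod_fintype _ _ (by simp), Fin.prod_univ_two, map_mul, map_mul, map_pow, map_pow]
  simp [Polynomial.algebraMap_apply]
end
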